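/- For every complex-valued function f on G, the trace of R_Γ(f) on V_Γ is given by the trace formula tr R_Γ(f) = (dim_ℂ V / |G|) · Σ_{g ∈ G} |X_Γ^g| · |Z_g| · f(C_g), where Z_g is the centralizer of g in G, C_g is the conjugacy class of g, and f(C_g) = Σ_{h ∈ C_g} f(h). -/

import Mathlib

open LinearMap Module Finset
open scoped Classical

/-- The right coset space `Γ\G`. -/
def RightCosetSpace (G : Type*) [Group G] (Γ : Subgroup G) : Type _ :=
  Quotient (QuotientGroup.rightRel Γ)

/-- Right multiplication by `g : G` on the right coset space `Γ\G`:  `x ↦ xg`. -/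
def cosetMulRight {G : Type*} [Group G] {Γ : Subgroup G} (g : G) :
    RightCosetSpace G Γ → RightCosetSpace G Γ :=
  Quotient.map' (· * g) fun a b h => by
    rw [QuotientGroup.rightRel_apply] at h ⊢
    simpa [mul_assoc] using h

/-- The trace of precomposition with `σ : X → X` on `X → V` is `dim V` times the number of fixed
points of `σ`. -/
theorem trace_funLeft_eq_finrank_mul_card_fixed {K X V : Type*} [Field K] [Finite X]
    [AddCommGroup V] [Module K V] [FiniteDimensional K V] (σ : X → X) :
    LinearMap.trace K (X → V) (LinearMap.funLeft K V σ) =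
      (finrank K V : K) * (Nat.card {x // σ x = x} : K) := by
  have := Fintype.ofFinite X
  let b := Module.finBasis K V
  rw [LinearMap.trace_eq_matrix_trace K (Pi.basis fun _ : X => b), Matrix.trace,
    Fintype.sum_sigma]
  have diag (x : X) (i : Fin (finrank K V)) :
      (LinearMap.toMatrix (Pi.basis fun _ : X => b) (Pi.basis fun _ : X => b)
        (LinearMap.funLeft K V σ)).diag ⟨x, i⟩ = if σ x = x then 1 else 0 := by
    rw [Matrix.diag_apply, LinearMap.toMatrix_apply, Pi.basis_repr, Pi.basis_apply,
      LinearMap.funLeft_apply]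
    split_ifs with h
    · simp [h]
    · simp [Pi.single_eq_of_ne h]
  simp only [diag, Finset.sum_const, Finset.card_univ, Fintype.card_fin, nsmul_eq_mul]
  rw [← Finset.mul_sum, Finset.sum_boole, Nat.card_eq_fintype_card, Fintype.card_subtype]

/-- Orbit-stabilizer for conjugation: the size of a centralizer times the size of the conjugacy
class is the order of the group. -/
theorem card_centralizer_mul_card_filter_isConj {G : Type*} [Group G] [Fintype G] (g : G) :
    Nat.card (Subgroup.centralizer {g}) * #{h | IsConj h g} = Fintype.card G := by
  have horbit : #{h | IsConj h g} = Fintype.card (MulAction.orbit (ConjAct G) g) := by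
    rw [← Set.toFinset_card]
    congr 1
    ext h
    simp [ConjAct.mem_orbit_conjAct]
  rw [Subgroup.nat_card_centralizer_nat_card_stabilizer, Nat.card_eq_fintype_card, horbit,
    mul_comm, MulAction.card_orbit_mul_card_stabilizer_eq_card_group, ConjAct.card]

/-- Centralizers of conjugate elements have the same size. -/
theorem card_centralizer_eq_of_isConj {G : Type*} [Group G] [Fintype G] {g h : G}
    (hgh : IsConj g h) :
    Nat.card (Subgroup.centralizer {g}) = Nat.card (Subgroup.centralizer {h}) := by
  have hclass : #{k | IsConj k g} = #{k | IsConj k h} := by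
    congr 1
    ext k
    simp only [Finset.mem_filter, Finset.mem_univ, true_and]
    exact ⟨fun hk => hk.trans hgh, fun hk => hk.trans hgh.symm⟩
  have hpos : 0 < #{k | IsConj k h} := Finset.card_pos.2 ⟨h, Finset.mem_filter.2 ⟨Finset.mem_univ h, IsConj.refl h⟩⟩
  refine Nat.eq_of_mul_eq_mul_right hpos ?_
  rw [card_centralizer_mul_card_filter_isConj, ← hclass, card_centralizer_mul_card_filter_isConj]

theorem cosetMulRight_mul {G : Type*} [Group G] {Γ : Subgroup G} (a b : G)
    (x : RightCosetSpace G Γ) :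
    cosetMulRight (a * b) x = cosetMulRight b (cosetMulRight a x) := by
  induction x using Quotient.inductionOn' with
  | h y => exact congrArg Quotient.mk'' (mul_assoc y a b).symm

theorem cosetMulRight_one {G : Type*} [Group G] {Γ : Subgroup G} (x : RightCosetSpace G Γ) :
    cosetMulRight 1 x = x := by
  induction x using Quotient.inductionOn' with
  | h y => exact congrArg Quotient.mk'' (mul_one y)

/-- Right multiplication by `g` as a permutation of `Γ\G`. -/
def cosetMulRightEquiv {G : Type*} [Group G] (Γ : Subgroup G) (g : G) :
    Equiv.Perm (RightCosetSpace G Γ) where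
  toFun := cosetMulRight g
  invFun := cosetMulRight g⁻¹
  left_inv x := by rw [← cosetMulRight_mul, mul_inv_cancel, cosetMulRight_one]
  right_inv x := by rw [← cosetMulRight_mul, inv_mul_cancel, cosetMulRight_one]

/-- Conjugate elements have the same number of fixed points on `Γ\G`. -/
theorem card_fixed_cosetMulRight_eq_of_isConj {G : Type*} [Group G] (Γ : Subgroup G) {g h : G}
    (hgh : IsConj g h) :
    Nat.card {x : RightCosetSpace G Γ // cosetMulRight g x = x} =
      Nat.card {x : RightCosetSpace G Γ // cosetMulRight h x = x} := by
  obtain ⟨c, rfl⟩ := isConj_iff.1 hgh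
  refine Nat.card_congr ((cosetMulRightEquiv Γ c⁻¹).subtypeEquiv fun x => ?_)
  change _ ↔ cosetMulRight (c * g * c⁻¹) (cosetMulRight c⁻¹ x) = cosetMulRight c⁻¹ x
  rw [← cosetMulRight_mul, mul_assoc, inv_mul_cancel_left, cosetMulRight_mul]
  exact (cosetMulRightEquiv Γ c⁻¹).injective.eq_iff.symm

/-- **Theorem 3, trace formula.** For every `f : G → ℂ`,
`tr R_Γ(f) = (dim_ℂ V / |G|) ⬝ Σ_{g ∈ G} |X_Γ^g| ⬝ |Z_g| ⬝ f(C_g)`, where `R_Γ(f) =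
Σ_g f(g) R_Γ(g)` acts on `V_Γ = {φ : Γ\G → V}`, `X_Γ^g = {x ∈ Γ\G | xg = x}`, `Z_g` is the
centralizer of `g`, `C_g` its conjugacy class and `f(C_g) = Σ_{h ∈ C_g} f(h)`. -/
theorem trace_right_regular_apply_eq
    {G : Type*} [Group G] [Fintype G] (Γ : Subgroup G)
    (V : Type*) [AddCommGroup V] [Module ℂ V] [FiniteDimensional ℂ V] (f : G → ℂ) :
    LinearMap.trace ℂ (RightCosetSpace G Γ → V)
        (∑ g : G, f g • LinearMap.funLeft ℂ V (cosetMulRight g)) =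
      (finrank ℂ V : ℂ) / (Fintype.card G : ℂ) *
        ∑ g : G, (Nat.card {x : RightCosetSpace G Γ // cosetMulRight g x = x} : ℂ) *
          (Nat.card (Subgroup.centralizer {g}) : ℂ) *
          (∑ h ∈ Finset.univ.filter (fun h => IsConj g h), f h) := by
  have : Finite (RightCosetSpace G Γ) := Quotient.finite _
  have hG : (Fintype.card G : ℂ) ≠ 0 := Nat.cast_ne_zero.2 Fintype.card_ne_zero
  have inner_sum (h : G) : ∑ g : G, (if IsConj g h then
      (Nat.card {x : RightCosetSpace G Γ // cosetMulRight g x = x} : ℂ) *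
        (Nat.card (Subgroup.centralizer {g}) : ℂ) * f h else 0) =
      Fintype.card G *
        (f h * (Nat.card {x : RightCosetSpace G Γ // cosetMulRight h x = x} : ℂ)) := by
    rw [← Finset.sum_filter, Finset.sum_congr rfl (g := fun _ =>
      (Nat.card {x : RightCosetSpace G Γ // cosetMulRight h x = x} : ℂ) *
        (Nat.card (Subgroup.centralizer {h}) : ℂ) * f h), Finset.sum_const, nsmul_eq_mul,
      ← card_centralizer_mul_card_filter_isConj h]
    · push_cast
      ring
    · intro g hg
      have hgh : IsConj g h := (Finset.mem_filter.1 hg).2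
      rw [card_fixed_cosetMulRight_eq_of_isConj Γ hgh, card_centralizer_eq_of_isConj hgh]
  have double_sum : ∑ g : G, (Nat.card {x : RightCosetSpace G Γ // cosetMulRight g x = x} : ℂ) *
      (Nat.card (Subgroup.centralizer {g}) : ℂ) *
        (∑ h ∈ Finset.univ.filter (fun h => IsConj g h), f h) =
      Fintype.card G *
        ∑ h : G, f h * (Nat.card {x : RightCosetSpace G Γ // cosetMulRight h x = x} : ℂ) := by
    simp only [Finset.mul_sum, Finset.sum_filter, mul_ite, mul_zero]
    rw [Finset.sum_comm]
    exact Finset.sum_congr rfl fun h _ => inner_sum h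
  rw [double_sum, ← mul_assoc, div_mul_cancel₀ _ hG, Finset.mul_sum]
  simp only [map_sum, map_smul, trace_funLeft_eq_finrank_mul_card_fixed, smul_eq_mul]
  exact Finset.sum_congr rfl fun g _ => by ring
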